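/- Let w be a positive integer and define, by strong recursion on i, probability mass functions T_i on ℕ: T_i is the law of the experiment that draws j uniformly from {0, 1, ..., w+i−1}, outputs 1 if j < w, and otherwise outputs 1 + X where X is drawn from T_{j−w} (note j−w < i). Then for every i ≥ 0, the expectation Σ_{a∈ℕ} a·T_i(a) equals 1 + Σ_{k=1}^{i} 1/(w+k). -/

import Mathlib

/-- `memT w hw i` : the law of the number of iterations of the external lookup loop of
MementoHash when the bucket first hit is the `(i+1)`-th most recently removed one:
draw `j` uniformly from `{0, …, w+i−1}`; output `1` if `j < w` (a working bucket is hit),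
otherwise output `1 + X` where `X ∼ memT w hw (j − w)`. -/
noncomputable def memT (w : ℕ) (hw : 0 < w) : ℕ → PMF ℕ
  | i =>
    haveI : Nonempty (Fin (w + i)) := ⟨⟨0, by omega⟩⟩
    (PMF.uniformOfFintype (Fin (w + i))).bind fun j =>
      if h : (j : ℕ) < w then PMF.pure 1
      else
        have hlt : (j : ℕ) - w < i := by have := j.isLt; omega
        (memT w hw ((j : ℕ) - w)).map (· + 1)
  termination_by i => i

theorem aux_map (p : PMF ℕ) (m : ℝ) (h : HasSum (fun a : ℕ => (a : ℝ) * (p a).toReal) m) :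
    HasSum (fun a : ℕ => (a : ℝ) * ((p.map (· + 1)) a).toReal) (m + 1) := by
  have h1 : HasSum (fun a : ℕ => (p a).toReal) 1 := by
    have h2 := ENNReal.hasSum_toReal (f := fun a => p a) (by rw [p.tsum_coe]; simp)
    rwa [← ENNReal.tsum_toReal_eq (fun a => p.apply_ne_top a), p.tsum_coe, ENNReal.toReal_one] at h2
  have hs : ∀ a : ℕ, (p.map (· + 1)) (a + 1) = p a := by
    intro a
    rw [PMF.map_apply, tsum_eq_single a]
    · simp
    · intro b hb
      rw [if_neg]
      omega
  rw [← hasSum_nat_add_iff' 1]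
  simp only [hs, Finset.sum_range_one, Nat.cast_zero, zero_mul, sub_zero]
  refine (h.add h1).congr_fun ?_ |> id
  intro a
  push_cast
  ring

theorem aux_rec (w i : ℕ) (hw : 0 < w) :
    ∑ k ∈ Finset.range i, (1 + (1 + ∑ k ∈ Finset.Icc 1 k, (1 : ℝ) / ((w : ℝ) + (k : ℝ))))
      = (w + i) * (∑ k ∈ Finset.Icc 1 i, (1 : ℝ) / ((w : ℝ) + (k : ℝ))) + i := by
  induction i with
  | zero => simp
  | succ n ih =>
    rw [Finset.sum_range_succ, ih, Finset.sum_Icc_succ_top (by omega)]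
    have : (w : ℝ) + ((n + 1 : ℕ) : ℝ) ≠ 0 := by positivity
    field_simp
    push_cast
    ring

theorem aux_main (w : ℕ) (hw : 0 < w) (i : ℕ) :
    HasSum (fun a : ℕ => (a : ℝ) * ((memT w hw i) a).toReal)
      (1 + ∑ k ∈ Finset.Icc 1 i, (1 : ℝ) / ((w : ℝ) + (k : ℝ))) := by
  induction i using Nat.strong_induction_on with
  | _ i ih =>
  let g : ℕ → PMF ℕ := fun j => if j < w then PMF.pure 1 else (memT w hw (j - w)).map (· + 1)
  let e : ℕ → ℝ := fun j => if j < w then 1 else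
    (1 + ∑ k ∈ Finset.Icc 1 (j - w), (1 : ℝ) / ((w : ℝ) + (k : ℝ))) + 1
  have hg : ∀ j ∈ Finset.range (w + i), HasSum (fun a : ℕ => (a : ℝ) * ((g j) a).toReal) (e j) := by
    intro j hj
    rw [Finset.mem_range] at hj
    by_cases h : j < w
    · simp only [g, e, if_pos h]
      convert hasSum_single (f := fun a : ℕ => (a : ℝ) * ((PMF.pure 1 : PMF ℕ) a).toReal) 1 ?_ using 1
      · simp
      · intro b hb
        simp [PMF.pure_apply, hb]
    · simp only [g, e, if_neg h]
      exact aux_map _ _ (ih _ (by omega))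
  have hT : ∀ a, ((memT w hw i) a).toReal
      = ((w : ℝ) + i)⁻¹ * ∑ j ∈ Finset.range (w + i), ((g j) a).toReal := by
    intro a
    rw [memT, PMF.bind_apply, tsum_fintype, ENNReal.toReal_sum, Finset.mul_sum, Finset.sum_range]
    · refine Finset.sum_congr rfl fun j _ => ?_
      rw [ENNReal.toReal_mul]
      congr 1
      · simp [PMF.uniformOfFintype_apply, ENNReal.toReal_inv, ENNReal.toReal_add]
    · intro j _
      exact ENNReal.mul_ne_top (PMF.apply_ne_top _ _) (PMF.apply_ne_top _ _)
  have H := (hasSum_sum hg).mul_left (((w : ℝ) + i)⁻¹)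
  have hf : (fun a : ℕ => (a : ℝ) * ((memT w hw i) a).toReal) = fun a : ℕ =>
      ((w : ℝ) + i)⁻¹ * ∑ j ∈ Finset.range (w + i), (a : ℝ) * ((g j) a).toReal := by
    funext a
    rw [hT, Finset.mul_sum, Finset.mul_sum, Finset.mul_sum]
    refine Finset.sum_congr rfl fun j _ => by ring
  have hv : (1 + ∑ k ∈ Finset.Icc 1 i, (1 : ℝ) / ((w : ℝ) + (k : ℝ)))
      = ((w : ℝ) + i)⁻¹ * ∑ j ∈ Finset.range (w + i), e j := by
    have : (w : ℝ) + i ≠ 0 := by positivity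
    have h1 : ∑ j ∈ Finset.range w, e j = w := by
      rw [Finset.sum_congr rfl (g := fun _ => (1 : ℝ))]
      · simp
      · intro j hj
        simp [e, Finset.mem_range.1 hj]
    have h2 : ∑ j ∈ Finset.range i, e (w + j) = (w + i) * (∑ k ∈ Finset.Icc 1 i, (1 : ℝ) / ((w : ℝ) + (k : ℝ))) + i := by
      rw [← aux_rec w i hw]
      refine Finset.sum_congr rfl fun j _ => ?_
      simp only [e, if_neg (show ¬ (w + j < w) by omega), Nat.add_sub_cancel_left]
      ring
    rw [Finset.sum_range_add, h1, h2]
    field_simp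
    ring
  rw [hf, hv]
  exact H

/-- The expectation of `memT w hw i` equals `1 + ∑_{k=1}^{i} 1/(w+k)`. -/
theorem stmt_8 (w : ℕ) (hw : 0 < w) (i : ℕ) :
    ∑' a : ℕ, (a : ℝ) * ((memT w hw i) a).toReal
      = 1 + ∑ k ∈ Finset.Icc 1 i, (1 : ℝ) / ((w : ℝ) + (k : ℝ)) := by
  exact (aux_main w hw i).tsum_eq
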